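/- Let n ≥ 1 and let a, b ∈ ℝ. Suppose that for every smooth symmetric contravariant 2-tensor field g^{ij} on ℝ^n the operator Q_{a,b}(g) f = g^{ij} ∂_i ∂_j f + a (∂_j g^{ij}) ∂_i f + b (∂_i ∂_j g^{ij}) f satisfies the equivariance relation Q_{a,b}(L_X g) = ℓ_X ∘ Q_{a,b}(g) − Q_{a,b}(g) ∘ ℓ_X for every X in the linear span of the projective generators ∂_i, x^i ∂_j, x^i E (E = x^j ∂_j), where (L_X g)^{ij} = X^k ∂_k g^{ij} − g^{kj} ∂_k X^i − g^{ik} ∂_k X^j and ℓ_X f = X^i ∂_i f + (1/2)(∂_i X^i) f. Then a = 1 and b = (n+1)/(4(n+2)). -/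

import Mathlib

set_option maxHeartbeats 1000000

/-- The `i`-th partial derivative of a function on `ℝⁿ`. -/
noncomputable def pd {n : ℕ} (i : Fin n) (f : (Fin n → ℝ) → ℝ) : (Fin n → ℝ) → ℝ :=
  fun x => fderiv ℝ f x (Pi.single i 1)

/-- The projective generators on ℝⁿ, viewed as vector fields (families of component
functions): `∂ᵢ`, `xⁱ∂ⱼ`, and `xⁱE` where `E = xʲ∂ⱼ`. -/
def projGenSm (n : ℕ) : Set (Fin n → (Fin n → ℝ) → ℝ) :=
  (Set.range fun i : Fin n => fun m (_ : Fin n → ℝ) => if m = i then (1 : ℝ) else 0) ∪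
  (Set.range fun p : Fin n × Fin n => fun m (x : Fin n → ℝ) =>
    if m = p.2 then x p.1 else 0) ∪
  (Set.range fun i : Fin n => fun m (x : Fin n → ℝ) => x i * x m)

/-- The Lie derivative of a symmetric contravariant 2-tensor along a vector field:
`(L_X g)^{ij} = X^k ∂_k g^{ij} − g^{kj} ∂_k X^i − g^{ik} ∂_k X^j`. -/
noncomputable def lieDer {n : ℕ} (Xv : Fin n → (Fin n → ℝ) → ℝ)
    (g : Fin n → Fin n → (Fin n → ℝ) → ℝ) : Fin n → Fin n → (Fin n → ℝ) → ℝ :=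
  fun i j x => ∑ k, (Xv k x * pd k (g i j) x
    - g k j x * pd k (Xv i) x - g i k x * pd k (Xv j) x)

/-- The action of a vector field on half-densities, in coordinates:
`ℓ_X f = Xⁱ ∂ᵢ f + (1/2)(∂ᵢ Xⁱ) f`. -/
noncomputable def halfDensAct {n : ℕ} (Xv : Fin n → (Fin n → ℝ) → ℝ)
    (f : (Fin n → ℝ) → ℝ) : (Fin n → ℝ) → ℝ :=
  fun x => (∑ i, Xv i x * pd i f x) + (1 / 2) * (∑ i, pd i (Xv i) x) * f x

/-- The candidate quantization map with undetermined coefficients `a`, `b`: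
`Q_{a,b}(g) f = g^{ij}∂ᵢ∂ⱼf + a (∂ⱼg^{ij})∂ᵢf + b (∂ᵢ∂ⱼg^{ij}) f`. -/
noncomputable def Qab {n : ℕ} (a b : ℝ) (g : Fin n → Fin n → (Fin n → ℝ) → ℝ)
    (f : (Fin n → ℝ) → ℝ) : (Fin n → ℝ) → ℝ :=
  fun x => (∑ i, ∑ j, g i j x * pd i (pd j f) x)
    + a * (∑ i, ∑ j, pd j (g i j) x * pd i f x)
    + b * (∑ i, ∑ j, pd i (pd j (g i j)) x) * f x

theorem pd_cst {n : ℕ} (i : Fin n) (c : ℝ) : pd i (fun _ => c) = fun _ => 0 := by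
  funext x; simp [pd]

theorem pd_lin {n : ℕ} (k i : Fin n) (c : ℝ) :
    pd k (fun x => c * x i) = fun _ => c * (if i = k then 1 else 0) := by
  funext x
  have h : HasFDerivAt (fun x : Fin n → ℝ => c * x i)
      (c • ContinuousLinearMap.proj (R := ℝ) (φ := fun _ : Fin n => ℝ) i) x :=
    (hasFDerivAt_apply i x).const_mul c
  simp [pd, h.fderiv, Pi.single_apply]

theorem pd_coord {n : ℕ} (k i : Fin n) :
    pd k (fun x => x i) = fun _ => (if i = k then 1 else 0) := by
  simpa using pd_lin k i 1

theorem pd_quad {n : ℕ} (k i j : Fin n) :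
    pd k (fun x => x i * x j) =
      fun x => (if j = k then 1 else 0) * x i + (if i = k then 1 else 0) * x j := by
  funext x
  have h := (hasFDerivAt_apply (𝕜 := ℝ) i x).mul (hasFDerivAt_apply (𝕜 := ℝ) j x)
  have h' : fderiv ℝ (fun x : Fin n → ℝ => x i * x j) x = _ := h.fderiv
  rw [pd, h']
  simp [Pi.single_apply, mul_comm]

theorem pd_add' {n : ℕ} (k : Fin n) {f g : (Fin n → ℝ) → ℝ} (hf : Differentiable ℝ f)
    (hg : Differentiable ℝ g) :
    pd k (fun x => f x + g x) = fun x => pd k f x + pd k g x := by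
  funext x
  simp only [pd]
  rw [fderiv_fun_add (hf x) (hg x)]; rfl

theorem pd_cmul {n : ℕ} (k : Fin n) (c : ℝ) {f : (Fin n → ℝ) → ℝ} (hf : Differentiable ℝ f) :
    pd k (fun x => c * f x) = fun x => c * pd k f x := by
  funext x
  simp only [pd]
  rw [fderiv_const_mul (hf x)]; rfl

/-- Uniqueness of the projectively equivariant quantization at weights `λ = μ = 1/2`
in the second-order case: if `Q_{a,b}` is equivariant under the projective algebra for
all smooth symmetric 2-tensors, then `a = 1` and `b = (n+1)/(4(n+2))`. -/
theorem stmt7 (n : ℕ) (hn : 1 ≤ n) (a b : ℝ)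
    (heq : ∀ g : Fin n → Fin n → (Fin n → ℝ) → ℝ,
      (∀ i j, ContDiff ℝ (⊤ : ℕ∞) (g i j)) → (∀ i j, g i j = g j i) →
      ∀ Xv ∈ Submodule.span ℝ (projGenSm n),
      ∀ f : (Fin n → ℝ) → ℝ, ContDiff ℝ (⊤ : ℕ∞) f → ∀ x,
        Qab a b (lieDer Xv g) f x
          = halfDensAct Xv (Qab a b g f) x - Qab a b g (halfDensAct Xv f) x) :
    a = 1 ∧ b = (n + 1) / (4 * (n + 2)) := by
  obtain ⟨e⟩ : Nonempty (Fin n) := ⟨⟨0, hn⟩⟩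
  have hX : (fun m (x : Fin n → ℝ) => x e * x m) ∈ Submodule.span ℝ (projGenSm n) :=
    Submodule.subset_span (Or.inr ⟨e, rfl⟩)
  have hz : ∀ F : (Fin n → ℝ) → ℝ,
      halfDensAct (fun m (x : Fin n → ℝ) => x e * x m) F 0 = 0 := by
    intro F
    simp [halfDensAct, pd_quad]
  have d1 : ∀ (k i j : Fin n) (c1 c2 c3 : ℝ),
      pd k (fun x => c1 * x e + (c2 * x i + c3 * x j)) = fun _ =>
        c1 * (if e = k then 1 else 0) + (c2 * (if i = k then 1 else 0)
          + c3 * (if j = k then 1 else 0)) := by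
    intro k i j c1 c2 c3
    rw [pd_add' k (by fun_prop) (by fun_prop), pd_add' k (by fun_prop) (by fun_prop)]
    simp only [pd_lin]
  have ha : a = 1 := by
    have h := heq (fun i j _ => (if i = e then 1 else 0) * (if j = e then 1 else 0))
      (fun i j => contDiff_const) (fun i j => by funext x; ring) _ hX
      (fun x => x e) (contDiff_apply ℝ ℝ e) 0
    rw [hz] at h
    have hL : lieDer (fun m (x : Fin n → ℝ) => x e * x m)
        (fun i j _ => (if i = e then 1 else 0) * (if j = e then 1 else 0)) =
        fun i j x => (-(2 * (if i = e then 1 else 0) * (if j = e then 1 else 0)) : ℝ) * x e + 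
          ((-(if j = e then 1 else 0)) * x i + (-(if i = e then 1 else 0)) * x j) := by
      funext i j x
      simp only [lieDer, pd_quad, pd_cst, Finset.sum_sub_distrib]
      simp [add_mul, mul_add, Finset.sum_add_distrib]
      split_ifs <;> (try simp_all) <;> (try ring)
    have hH : halfDensAct (fun m (x : Fin n → ℝ) => x e * x m) (fun x => x e) =
        fun x => ((n + 3) / 2 : ℝ) * (x e * x e) := by
      funext x
      simp [halfDensAct, pd_quad, pd_coord, Finset.sum_add_distrib]
      ring
    rw [hL, hH] at h
    have hq : ∀ k, pd k (fun x : Fin n → ℝ => ((n + 3) / 2 : ℝ) * (x e * x e)) =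
        fun x => ((n + 3) * (if e = k then 1 else 0) : ℝ) * x e := by
      intro k
      rw [pd_cmul k _ (by fun_prop), pd_quad]
      funext x; ring
    simp only [Qab, d1, hq, pd_lin, pd_coord, pd_cst] at h
    simp [mul_add, add_mul, Finset.sum_add_distrib] at h
    have hn' : (0 : ℝ) < n + 3 := by positivity
    have : (a - 1) * (n + 3) = 0 := by linarith
    rcases mul_eq_zero.1 this with h | h <;> linarith
  refine ⟨ha, ?_⟩
  have h := heq (fun i j x => ((if i = e then 1 else 0) * (if j = e then 1 else 0)) * x e)
      (fun i j => by fun_prop) (fun i j => by funext x; ring) _ hX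
      (fun x => 1) contDiff_const 0
  rw [hz] at h
  have hL : lieDer (fun m (x : Fin n → ℝ) => x e * x m)
      (fun i j x => ((if i = e then 1 else 0) * (if j = e then 1 else 0)) * x e) =
      fun i j x => (-((if i = e then 1 else 0) * (if j = e then 1 else 0)) : ℝ) * (x e * x e) + 
        ((-(if j = e then 1 else 0)) * (x e * x i) + (-(if i = e then 1 else 0)) * (x e * x j)) := by
    funext i j x
    simp only [lieDer, pd_quad, pd_lin, Finset.sum_sub_distrib]
    simp [add_mul, mul_add, Finset.sum_add_distrib]
    split_ifs <;> (try simp_all) <;> (try ring)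
  have hH : halfDensAct (fun m (x : Fin n → ℝ) => x e * x m) (fun x => 1) =
      fun x => ((n + 1) / 2 : ℝ) * x e := by
    funext x
    simp [halfDensAct, pd_quad, pd_cst, Finset.sum_add_distrib]
    ring
  have d2 : ∀ (k i j : Fin n) (c1 c2 c3 : ℝ),
      pd k (fun x => c1 * (x e * x e) + (c2 * (x e * x i) + c3 * (x e * x j))) = fun x =>
        (2 * c1 * (if e = k then 1 else 0) + c2 * (if i = k then 1 else 0)
          + c3 * (if j = k then 1 else 0)) * x e
        + ((c2 * (if e = k then 1 else 0)) * x i + (c3 * (if e = k then 1 else 0)) * x j) := by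
    intro k i j c1 c2 c3
    rw [pd_add' k (by fun_prop) (by fun_prop), pd_add' k (by fun_prop) (by fun_prop),
      pd_cmul k _ (by fun_prop), pd_cmul k _ (by fun_prop), pd_cmul k _ (by fun_prop)]
    simp only [pd_quad]
    funext x; ring
  rw [hL, hH] at h
  simp only [Qab, d1, d2, pd_lin, pd_cst] at h
  simp [mul_add, add_mul, Finset.sum_add_distrib] at h
  have hn' : (0 : ℝ) < 4 * (n + 2) := by positivity
  rw [eq_div_iff hn'.ne']
  subst ha
  linarith
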